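/- Suppose f is three times continuously differentiable and satisfies the scaled 1D LRTE on τ × D × [-1,1]. Then the angular average ρ = ⟨f⟩ satisfies the macroscopic auxiliary equation: for every (t,x) ∈ τ × D, ∂_t ρ − (1/3) ∂_x( (1/σ(x)) ∂_x ρ ) + α(x) ρ − G(x) − ε ⟨σ 𝒜(f)⟩(t,x) − ε² ⟨σ ℬ(f)⟩(t,x) = 0, where ⟨σ 𝒜(f)⟩(t,x) = (1/2) ∫_{-1}^{1} σ(x) 𝒜(f)(t,x,μ) dμ and analogously for ⟨σ ℬ(f)⟩. -/

import Mathlib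

open MeasureTheory Real intervalIntegral

/-- The partial derivative `∂_t f` of `f = f(t,x,μ)` in the time variable. -/
noncomputable def pt (f : ℝ → ℝ → ℝ → ℝ) (t x μ : ℝ) : ℝ := deriv (fun s => f s x μ) t

/-- The partial derivative `∂_x f` of `f = f(t,x,μ)` in the space variable. -/
noncomputable def px (f : ℝ → ℝ → ℝ → ℝ) (t x μ : ℝ) : ℝ := deriv (fun y => f t y μ) x

/-- The angular average `⟨f⟩(t,x) = (1/2) ∫_{-1}^{1} f(t,x,μ) dμ`. -/
noncomputable def avg (f : ℝ → ℝ → ℝ → ℝ) (t x : ℝ) : ℝ :=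
  (1 / 2) * ∫ μ in (-1 : ℝ)..1, f t x μ

/-- `f` satisfies the scaled 1D linear radiative transfer equation
`ε² ∂_t f + ε μ ∂_x f = σ(x)(⟨f⟩ − f) − ε² α(x) f + ε² G(x)`
on `(0,T) × (x_L,x_R) × [-1,1]`. -/
def SolvesLRTE (ε T xL xR : ℝ) (σ α G : ℝ → ℝ) (f : ℝ → ℝ → ℝ → ℝ) : Prop :=
  ∀ t ∈ Set.Ioo (0 : ℝ) T, ∀ x ∈ Set.Ioo xL xR, ∀ μ ∈ Set.Icc (-1 : ℝ) 1,
    ε ^ 2 * pt f t x μ + ε * μ * px f t x μ =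
      σ x * (avg f t x - f t x μ) - ε ^ 2 * α x * f t x μ + ε ^ 2 * G x

/-- The macroscopic auxiliary operator
`𝒜(f) = (1/σ) ∂_t((1/σ) μ ∂_x f) + (1/σ) μ ∂_x( (1/σ)( ∂_t f + α f − G − μ ∂_x((1/σ) μ ∂_x f) ) )`. -/
noncomputable def opA (σ α G : ℝ → ℝ) (f : ℝ → ℝ → ℝ → ℝ) : ℝ → ℝ → ℝ → ℝ :=
  fun t x μ =>
    (1 / σ x) * pt (fun t' x' μ' => (1 / σ x') * μ' * px f t' x' μ') t x μ
    + (1 / σ x) * μ *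
        px (fun t' x' μ' => (1 / σ x') *
          (pt f t' x' μ' + α x' * f t' x' μ' - G x'
            - μ' * px (fun s y ν => (1 / σ y) * ν * px f s y ν) t' x' μ')) t x μ

/-- The macroscopic auxiliary operator
`ℬ(f) = (1/σ²) ∂_t( ∂_t f + α f − G ) − (1/σ) μ ∂_x( (1/σ) μ ∂_x( (1/σ)( ∂_t f + α f − G ) ) )`. -/
noncomputable def opB (σ α G : ℝ → ℝ) (f : ℝ → ℝ → ℝ → ℝ) : ℝ → ℝ → ℝ → ℝ :=
  fun t x μ =>
    (1 / (σ x) ^ 2) * pt (fun t' x' μ' => pt f t' x' μ' + α x' * f t' x' μ' - G x') t x μ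
    - (1 / σ x) * μ *
        px (fun t' x' μ' => (1 / σ x') * μ' *
          px (fun s y ν => (1 / σ y) * (pt f s y ν + α y * f s y ν - G y)) t' x' μ') t x μ

lemma hasDerivAt_half_integral (F F' : ℝ → ℝ → ℝ)
    (hF : Continuous (fun p : ℝ × ℝ => F p.1 p.2))
    (hF' : Continuous (fun p : ℝ × ℝ => F' p.1 p.2))
    (hd : ∀ y m, HasDerivAt (fun z => F z m) (F' y m) y) (y : ℝ) :
    HasDerivAt (fun z => (1 / 2 : ℝ) * ∫ m in (-1 : ℝ)..1, F z m)
      ((1 / 2 : ℝ) * ∫ m in (-1 : ℝ)..1, F' y m) y := by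
  apply HasDerivAt.const_mul
  have hK : IsCompact (Set.Icc (y - 1) (y + 1) ×ˢ Set.Icc (-1 : ℝ) 1) :=
    isCompact_Icc.prod isCompact_Icc
  obtain ⟨C, hC⟩ := hK.exists_bound_of_continuousOn hF'.continuousOn
  have hc : ∀ z, Continuous (F z) := fun z =>
    hF.comp (by fun_prop : Continuous fun m : ℝ => ((z, m) : ℝ × ℝ))
  have hc' : ∀ z, Continuous (F' z) := fun z =>
    hF'.comp (by fun_prop : Continuous fun m : ℝ => ((z, m) : ℝ × ℝ))
  refine (intervalIntegral.hasDerivAt_integral_of_dominated_loc_of_deriv_le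
    (s := Set.Icc (y - 1) (y + 1)) (bound := fun _ => C) (F' := F')
    (Icc_mem_nhds (by linarith) (by linarith)) ?_ ?_ ?_ ?_ ?_ ?_).2
  · exact Filter.Eventually.of_forall fun z => (hc z).aestronglyMeasurable
  · exact (hc y).intervalIntegrable _ _
  · exact (hc' y).aestronglyMeasurable
  · refine Filter.Eventually.of_forall fun m hm z hz => ?_
    rw [Set.uIoc_of_le (by norm_num)] at hm
    exact hC (z, m) ⟨hz, hm.1.le, hm.2⟩
  · exact intervalIntegrable_const
  · exact Filter.Eventually.of_forall fun m _ z _ => hd z m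

/-- joint regularity -/
def CD (n : ℕ) (f : ℝ → ℝ → ℝ → ℝ) : Prop :=
  ContDiff ℝ n (fun p : ℝ × ℝ × ℝ => f p.1 p.2.1 p.2.2)

lemma CD.hasX {n : ℕ} {f : ℝ → ℝ → ℝ → ℝ} (hf : CD (n + 1) f) (t x m : ℝ) :
    HasDerivAt (fun y => f t y m) (px f t x m) x := by
  have h1 : ContDiff ℝ ((n + 1 : ℕ) : WithTop ℕ∞) (fun y : ℝ => f t y m) :=
    ContDiff.comp hf (by fun_prop :
      ContDiff ℝ ((n + 1 : ℕ) : WithTop ℕ∞) (fun y : ℝ => ((t, y, m) : ℝ × ℝ × ℝ)))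
  exact (h1.differentiable (by simp)).differentiableAt.hasDerivAt

lemma CD.hasT {n : ℕ} {f : ℝ → ℝ → ℝ → ℝ} (hf : CD (n + 1) f) (t x m : ℝ) :
    HasDerivAt (fun s => f s x m) (pt f t x m) t := by
  have h1 : ContDiff ℝ ((n + 1 : ℕ) : WithTop ℕ∞) (fun s : ℝ => f s x m) :=
    ContDiff.comp hf (by fun_prop :
      ContDiff ℝ ((n + 1 : ℕ) : WithTop ℕ∞) (fun s : ℝ => ((s, x, m) : ℝ × ℝ × ℝ)))
  exact (h1.differentiable (by simp)).differentiableAt.hasDerivAt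

lemma CD.px {n : ℕ} {f : ℝ → ℝ → ℝ → ℝ} (hf : CD (n + 1) f) : CD n (px f) := by
  have hd : Differentiable ℝ (fun p : ℝ × ℝ × ℝ => f p.1 p.2.1 p.2.2) :=
    ContDiff.differentiable hf (by simp)
  have h2 : ContDiff ℝ n (fun p : ℝ × ℝ × ℝ =>
      fderiv ℝ (fun p : ℝ × ℝ × ℝ => f p.1 p.2.1 p.2.2) p (0, 1, 0)) :=
    (ContDiff.fderiv_right hf (by simp)).clm_apply contDiff_const
  unfold CD
  convert h2 using 2 with p
  obtain ⟨t, x, m⟩ := p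
  have hc : HasDerivAt (fun y : ℝ => ((t, y, m) : ℝ × ℝ × ℝ)) (0, 1, 0) x :=
    (hasDerivAt_const x t).prodMk ((hasDerivAt_id x).prodMk (hasDerivAt_const x m))
  exact ((hd (t, x, m)).hasFDerivAt.comp_hasDerivAt x hc).deriv

lemma CD.pt {n : ℕ} {f : ℝ → ℝ → ℝ → ℝ} (hf : CD (n + 1) f) : CD n (pt f) := by
  have hd : Differentiable ℝ (fun p : ℝ × ℝ × ℝ => f p.1 p.2.1 p.2.2) :=
    ContDiff.differentiable hf (by simp)
  have h2 : ContDiff ℝ n (fun p : ℝ × ℝ × ℝ =>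
      fderiv ℝ (fun p : ℝ × ℝ × ℝ => f p.1 p.2.1 p.2.2) p (1, 0, 0)) :=
    (ContDiff.fderiv_right hf (by simp)).clm_apply contDiff_const
  unfold CD
  convert h2 using 2 with p
  obtain ⟨t, x, m⟩ := p
  have hc : HasDerivAt (fun y : ℝ => ((y, x, m) : ℝ × ℝ × ℝ)) (1, 0, 0) t :=
    (hasDerivAt_id t).prodMk ((hasDerivAt_const t x).prodMk (hasDerivAt_const t m))
  exact ((hd (t, x, m)).hasFDerivAt.comp_hasDerivAt t hc).deriv

lemma CD.cont {n : ℕ} {f : ℝ → ℝ → ℝ → ℝ} (hf : CD n f) :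
    Continuous (fun p : ℝ × ℝ × ℝ => f p.1 p.2.1 p.2.2) := ContDiff.continuous hf

lemma CD.contM {n : ℕ} {f : ℝ → ℝ → ℝ → ℝ} (hf : CD n f) (t x : ℝ) :
    Continuous (fun m => f t x m) :=
  hf.cont.comp (by fun_prop : Continuous fun m : ℝ => ((t, x, m) : ℝ × ℝ × ℝ))

lemma CD.avgX {n : ℕ} {f : ℝ → ℝ → ℝ → ℝ} (hf : CD (n + 1) f) (t x : ℝ) :
    HasDerivAt (fun y => avg f t y) (avg (_root_.px f) t x) x :=
  hasDerivAt_half_integral (fun y m => f t y m) (fun y m => _root_.px f t y m)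
    (hf.cont.comp (by fun_prop : Continuous fun q : ℝ × ℝ => ((t, q.1, q.2) : ℝ × ℝ × ℝ)))
    (hf.px.cont.comp (by fun_prop : Continuous fun q : ℝ × ℝ => ((t, q.1, q.2) : ℝ × ℝ × ℝ)))
    (fun y m => hf.hasX t y m) x

lemma CD.avgT {n : ℕ} {f : ℝ → ℝ → ℝ → ℝ} (hf : CD (n + 1) f) (t x : ℝ) :
    HasDerivAt (fun s => avg f s x) (avg (_root_.pt f) t x) t :=
  hasDerivAt_half_integral (fun y m => f y x m) (fun y m => _root_.pt f y x m)
    (hf.cont.comp (by fun_prop : Continuous fun q : ℝ × ℝ => ((q.1, x, q.2) : ℝ × ℝ × ℝ)))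
    (hf.pt.cont.comp (by fun_prop : Continuous fun q : ℝ × ℝ => ((q.1, x, q.2) : ℝ × ℝ × ℝ)))
    (fun y m => hf.hasT y x m) t

lemma CD.divσ {n : ℕ} {f : ℝ → ℝ → ℝ → ℝ} {σ : ℝ → ℝ} (hf : CD n f) (hσ : ContDiff ℝ n σ)
    (hσpos : ∀ x, 0 < σ x) : CD n (fun t x m => (1 / σ x) * f t x m) := by
  unfold CD at *
  have h1 : ContDiff ℝ n (fun p : ℝ × ℝ × ℝ => σ p.2.1) := hσ.comp (by fun_prop)
  exact (contDiff_const.div h1 (fun p => (hσpos _).ne')).mul hf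

/-- If `f` is three times continuously differentiable and satisfies the scaled 1D LRTE on
`τ × D × [-1,1]`, then the angular average `ρ = ⟨f⟩` satisfies the macroscopic auxiliary
equation `∂_t ρ − (1/3)∂_x((1/σ)∂_x ρ) + α ρ − G − ε ⟨σ𝒜(f)⟩ − ε² ⟨σℬ(f)⟩ = 0` on `τ × D`. -/
theorem macroscopic_auxiliary_equation
    (ε T xL xR : ℝ) (σ α G : ℝ → ℝ) (f : ℝ → ℝ → ℝ → ℝ)
    (hε : 0 < ε) (hT : 0 < T) (hD : xL < xR)
    (hσ : ContDiff ℝ 2 σ) (hσpos : ∀ x, 0 < σ x)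
    (hα : ContDiff ℝ 1 α) (hG : ContDiff ℝ 1 G)
    (hf : ContDiff ℝ 3 (fun p : ℝ × ℝ × ℝ => f p.1 p.2.1 p.2.2))
    (hsol : SolvesLRTE ε T xL xR σ α G f) :
    ∀ t ∈ Set.Ioo (0 : ℝ) T, ∀ x ∈ Set.Ioo xL xR,
      deriv (fun s => avg f s x) t
        - (1 / 3) * deriv (fun y => (1 / σ y) * deriv (fun y' => avg f t y') y) x
        + α x * avg f t x - G x
        - ε * ((1 / 2) * ∫ μ in (-1 : ℝ)..1, σ x * opA σ α G f t x μ)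
        - ε ^ 2 * ((1 / 2) * ∫ μ in (-1 : ℝ)..1, σ x * opB σ α G f t x μ) = 0 := by
  intro t ht x hx
  have hf3 : CD 3 f := hf
  have hσ1 : ContDiff ℝ 1 σ := hσ.of_le (by norm_num)
  have hσ0 : ∀ y, σ y ≠ 0 := fun y => (hσpos y).ne'
  have hε0 : ε ≠ 0 := hε.ne'
  obtain ⟨w, hw⟩ : ∃ w : ℝ → ℝ → ℝ → ℝ, w = fun t x m => (1 / σ x) * px f t x m := ⟨_, rfl⟩
  have hw2 : CD 2 w := by
    rw [hw]; exact CD.divσ (CD.px hf3) (by exact_mod_cast hσ) hσpos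
  obtain ⟨v, hv⟩ : ∃ v : ℝ → ℝ → ℝ → ℝ, v = fun t x m => (1 / σ x) * px w t x m := ⟨_, rfl⟩
  have hv1 : CD 1 v := by
    rw [hv]; exact CD.divσ (CD.px hw2) (by exact_mod_cast hσ1) hσpos
  have hσd : ∀ y, DifferentiableAt ℝ σ y := fun y => (hσ1.differentiable (by simp)) y
  -- averages
  have hρx : ∀ y, HasDerivAt (fun y' => avg f t y') (avg (px f) t y) y := fun y => hf3.avgX t y
  have hρt := hf3.avgT t x
  obtain ⟨R, hR⟩ : ∃ R, HasDerivAt (fun y => (1 / σ y) * avg (px f) t y) R x := by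
    have h1 := (CD.px hf3).avgX t x
    have h2 : DifferentiableAt ℝ (fun y => 1 / σ y) x :=
      (differentiableAt_const _).div (hσd x) (hσ0 x)
    exact ⟨_, (h2.mul h1.differentiableAt).hasDerivAt⟩
  have hRd : deriv (fun y => (1 / σ y) * deriv (fun y' => avg f t y') y) x = R := by
    have : (fun y => (1 / σ y) * deriv (fun y' => avg f t y') y)
        = (fun y => (1 / σ y) * avg (px f) t y) := by
      funext y; rw [(hρx y).deriv]
    rw [this, hR.deriv]
  -- the equation
  have key : ∀ s ∈ Set.Ioo (0 : ℝ) T, ∀ y ∈ Set.Ioo xL xR, ∀ m ∈ Set.Icc (-1 : ℝ) 1,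
      pt f s y m + α y * f s y m - G y
        = σ y * ((avg f s y - f s y m - ε * m * w s y m) / ε ^ 2) := by
    intro s hs y hy m hm
    have h := hsol s hs y hy m hm
    rw [hw]
    have := hσ0 y
    field_simp
    linarith
  have hxn : Set.Ioo xL xR ∈ nhds x := Ioo_mem_nhds hx.1 hx.2
  have htn : Set.Ioo (0 : ℝ) T ∈ nhds t := Ioo_mem_nhds ht.1 ht.2
  have hpu : ∀ s y m, px (fun s y ν => (1 / σ y) * ν * px f s y ν) s y m = m * px w s y m := by
    intro s y m
    have : HasDerivAt (fun z => (1 / σ z) * m * px f s z m) (m * px w s y m) y := by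
      refine ((hw2.hasX s y m).const_mul m).congr_of_eventuallyEq
        (Filter.Eventually.of_forall fun z => ?_)
      simp only [hw]; ring
    exact this.deriv
  have hA : ∀ m ∈ Set.Icc (-1 : ℝ) 1, σ x * opA σ α G f t x m =
      m * pt w t x m + m * ((avg (px f) t x - px f t x m - ε * m * px w t x m) / ε ^ 2
        - m * m * px v t x m) := by
    intro m hm
    have h1 : pt (fun t' x' μ' => (1 / σ x') * μ' * px f t' x' μ') t x m = m * pt w t x m := by
      have : HasDerivAt (fun s => (1 / σ x) * m * px f s x m) (m * pt w t x m) t := by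
        refine ((hw2.hasT t x m).const_mul m).congr_of_eventuallyEq
          (Filter.Eventually.of_forall fun z => ?_)
        simp only [hw]; ring
      exact this.deriv
    have h2 : px (fun t' x' μ' => (1 / σ x') *
          (pt f t' x' μ' + α x' * f t' x' μ' - G x'
            - μ' * px (fun s y ν => (1 / σ y) * ν * px f s y ν) t' x' μ')) t x m
        = (avg (px f) t x - px f t x m - ε * m * px w t x m) / ε ^ 2
          - m * m * px v t x m := by
      have : HasDerivAt (fun y => (1 / σ y) *
          (pt f t y m + α y * f t y m - G y
            - m * px (fun s y ν => (1 / σ y) * ν * px f s y ν) t y m))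
          ((avg (px f) t x - px f t x m - ε * m * px w t x m) / ε ^ 2
          - m * m * px v t x m) x := by
        refine (((((hρx x).sub (hf3.hasX t x m)).sub
          ((hw2.hasX t x m).const_mul (ε * m))).div_const (ε ^ 2)).sub
          ((hv1.hasX t x m).const_mul (m * m))).congr_of_eventuallyEq ?_
        filter_upwards [hxn] with y hy
        rw [hpu, key t ht y hy m hm]
        simp only [Pi.sub_apply, hv]
        have := hσ0 y
        field_simp
      exact this.deriv
    unfold opA
    rw [h1, h2]
    have := hσ0 x
    field_simp
  have hB : ∀ m ∈ Set.Icc (-1 : ℝ) 1, σ x * opB σ α G f t x m =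
      (avg (pt f) t x - pt f t x m - ε * m * pt w t x m) / ε ^ 2
      - m * (m * ((R - px w t x m - ε * m * px v t x m) / ε ^ 2)) := by
    intro m hm
    have h1 : pt (fun t' x' μ' => pt f t' x' μ' + α x' * f t' x' μ' - G x') t x m
        = σ x * ((avg (pt f) t x - pt f t x m - ε * m * pt w t x m) / ε ^ 2) := by
      have : HasDerivAt (fun s => pt f s x m + α x * f s x m - G x)
          (σ x * ((avg (pt f) t x - pt f t x m - ε * m * pt w t x m) / ε ^ 2)) t := by
        refine ((((hρt.sub (hf3.hasT t x m)).sub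
          ((hw2.hasT t x m).const_mul (ε * m))).div_const (ε ^ 2)).const_mul
            (σ x)).congr_of_eventuallyEq ?_
        filter_upwards [htn] with s hs
        rw [key s hs x hx m hm]
        simp only [Pi.sub_apply]
      exact this.deriv
    have h2 : ∀ y ∈ Set.Ioo xL xR,
        px (fun s y ν => (1 / σ y) * (pt f s y ν + α y * f s y ν - G y)) t y m
        = (avg (px f) t y - px f t y m - ε * m * px w t y m) / ε ^ 2 := by
      intro y hy
      have : HasDerivAt (fun y => (1 / σ y) * (pt f t y m + α y * f t y m - G y))
          ((avg (px f) t y - px f t y m - ε * m * px w t y m) / ε ^ 2) y := by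
        refine ((((hρx y).sub (hf3.hasX t y m)).sub
          ((hw2.hasX t y m).const_mul (ε * m))).div_const (ε ^ 2)).congr_of_eventuallyEq ?_
        filter_upwards [Ioo_mem_nhds hy.1 hy.2] with z hz
        rw [key t ht z hz m hm]
        simp only [Pi.sub_apply]
        have := hσ0 z
        field_simp
      exact this.deriv
    have h3 : px (fun t' x' μ' => (1 / σ x') * μ' *
          px (fun s y ν => (1 / σ y) * (pt f s y ν + α y * f s y ν - G y)) t' x' μ') t x m
        = m * ((R - px w t x m - ε * m * px v t x m) / ε ^ 2) := by
      have : HasDerivAt (fun x' => (1 / σ x') * m *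
          px (fun s y ν => (1 / σ y) * (pt f s y ν + α y * f s y ν - G y)) t x' m)
          (m * ((R - px w t x m - ε * m * px v t x m) / ε ^ 2)) x := by
        refine ((((hR.sub (hw2.hasX t x m)).sub
          ((hv1.hasX t x m).const_mul (ε * m))).div_const (ε ^ 2)).const_mul
            m).congr_of_eventuallyEq ?_
        filter_upwards [hxn] with y hy
        rw [h2 y hy]
        simp only [Pi.sub_apply, hv, hw]
        ring
      exact this.deriv
    unfold opB
    rw [h1, h3]
    have := hσ0 x
    field_simp
  have cpf := (CD.px hf3).contM t x
  have cptf := (CD.pt hf3).contM t x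
  have cf := hf3.contM t x
  have cpw := (CD.px hw2).contM t x
  have cptw := (CD.pt hw2).contM t x
  have cpv := (CD.px hv1).contM t x
  have hu : Set.uIcc (-1 : ℝ) 1 = Set.Icc (-1) 1 := Set.uIcc_of_le (by norm_num)
  rw [intervalIntegral.integral_congr (fun m hm => hA m (hu ▸ hm)),
    intervalIntegral.integral_congr (fun m hm => hB m (hu ▸ hm)), hRd, hρt.deriv]
  -- combination of the two integrals
  have comb : ε * (∫ m in (-1 : ℝ)..1,
        (m * pt w t x m + m * ((avg (px f) t x - px f t x m - ε * m * px w t x m) / ε ^ 2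
        - m * m * px v t x m)))
      + ε ^ 2 * (∫ m in (-1 : ℝ)..1,
        ((avg (pt f) t x - pt f t x m - ε * m * pt w t x m) / ε ^ 2
      - m * (m * ((R - px w t x m - ε * m * px v t x m) / ε ^ 2))))
      = ∫ m in (-1 : ℝ)..1, (avg (pt f) t x - R * m ^ 2 + (avg (px f) t x / ε) * m
          + (α x * f t x m - G x) + (1 / ε ^ 2) * (σ x * (f t x m - avg f t x))) := by
    rw [← intervalIntegral.integral_const_mul, ← intervalIntegral.integral_const_mul,
      ← intervalIntegral.integral_add]
    · refine intervalIntegral.integral_congr fun m hm => ?_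
      have h := hsol t ht x hx m (hu ▸ hm)
      have h' : pt f t x m = (σ x * (avg f t x - f t x m) - ε ^ 2 * α x * f t x m
        + ε ^ 2 * G x - ε * m * px f t x m) / ε ^ 2 := by
        field_simp; linarith
      simp only [h']
      field_simp
      ring
    · exact Continuous.intervalIntegrable (by fun_prop) _ _
    · exact Continuous.intervalIntegrable (by fun_prop) _ _
  have hint : (∫ m in (-1 : ℝ)..1, (avg (pt f) t x - R * m ^ 2 + (avg (px f) t x / ε) * m
          + (α x * f t x m - G x) + (1 / ε ^ 2) * (σ x * (f t x m - avg f t x))))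
      = 2 * avg (pt f) t x - R * (2 / 3) + 2 * (α x * avg f t x) - 2 * G x := by
    have hI : ∫ m in (-1 : ℝ)..1, f t x m = 2 * avg f t x := by unfold avg; ring
    have e : ∀ m : ℝ, (avg (pt f) t x - R * m ^ 2 + (avg (px f) t x / ε) * m
          + (α x * f t x m - G x) + (1 / ε ^ 2) * (σ x * (f t x m - avg f t x)))
        = (((avg (pt f) t x - G x - (1 / ε ^ 2) * σ x * avg f t x) - R * m ^ 2)
          + (avg (px f) t x / ε) * m) + (α x + (1 / ε ^ 2) * σ x) * f t x m := fun m => by ring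
    simp only [e]
    rw [intervalIntegral.integral_add (Continuous.intervalIntegrable (by fun_prop) _ _)
        (Continuous.intervalIntegrable (by fun_prop) _ _),
      intervalIntegral.integral_add (Continuous.intervalIntegrable (by fun_prop) _ _)
        (Continuous.intervalIntegrable (by fun_prop) _ _),
      intervalIntegral.integral_sub (Continuous.intervalIntegrable (by fun_prop) _ _)
        (Continuous.intervalIntegrable (by fun_prop) _ _),
      intervalIntegral.integral_const_mul, intervalIntegral.integral_const_mul,
      intervalIntegral.integral_const_mul, hI, integral_pow, integral_id,
      intervalIntegral.integral_const]
    norm_num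
    ring
  rw [hint] at comb
  linear_combination (-1 / 2) * comb
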